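/- Let G be a finite simple graph. Let J(G) denote the set of ordered pairs (A, B) of vertex subsets of G such that no edge of G joins a vertex of A to a vertex of B, and the subgraph of G induced by A ∪ B is bipartite. Then there is a bijection between I(G) × I(G) and J(G); in particular |J(G)| = i(G)². -/

import Mathlib

open Finset
open scoped Classical

/-- The collection of independent sets of `G`, as a finset of finsets. -/
noncomputable def indepSets {V : Type*} [Fintype V] (G : SimpleGraph V) :
    Finset (Finset V) :=
  Finset.univ.filter fun S : Finset V => ∀ u ∈ S, ∀ v ∈ S, ¬ G.Adj u v

/-- `J(G)`: the set of ordered pairs `(A, B)` of vertex subsets such that no edge of `G`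
joins a vertex of `A` to a vertex of `B`, and the subgraph induced by `A ∪ B` is
bipartite (i.e. 2-colorable). -/
noncomputable def crossIndepBipPairs {V : Type*} [Fintype V] (G : SimpleGraph V) :
    Finset (Finset V × Finset V) :=
  Finset.univ.filter fun p : Finset V × Finset V =>
    (∀ a ∈ p.1, ∀ b ∈ p.2, ¬ G.Adj a b) ∧
      (G.induce (↑(p.1 ∪ p.2) : Set V)).Colorable 2

/-- `c` separates the endpoints of every edge of `G` inside `W`. -/
def SplitsEdges {V : Type*} (G : SimpleGraph V) (W : Finset V) (c : V → Prop) : Prop :=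
  ∀ u ∈ W, ∀ v ∈ W, G.Adj u v → ¬ (c u ↔ c v)

theorem colorable_two_induce_iff {V : Type*} (G : SimpleGraph V) (W : Finset V) :
    (G.induce (W : Set V)).Colorable 2 ↔ ∃ c, SplitsEdges G W c := by
  constructor
  · rintro ⟨C⟩
    refine ⟨fun v => ∃ h : v ∈ (W : Set V), C ⟨v, h⟩ = 0, fun u hu v hv huv hc => ?_⟩
    have hne : C ⟨u, hu⟩ ≠ C ⟨v, hv⟩ := C.valid huv
    have hiff : C ⟨u, hu⟩ = 0 ↔ C ⟨v, hv⟩ = 0 := by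
      simpa [Finset.mem_coe.2 hu, Finset.mem_coe.2 hv, hu, hv] using hc
    omega
  · rintro ⟨c, hc⟩
    refine ⟨SimpleGraph.Coloring.mk (fun v => if c v then 0 else 1) fun {u v} huv => ?_⟩
    have := hc u u.2 v v.2 huv
    by_cases hu : c u <;> by_cases hv : c v <;> simp_all

/-- A fixed choice of an edge-splitting predicate on `W`, whenever one exists. -/
noncomputable def splitting {V : Type*} (G : SimpleGraph V) (W : Finset V) : V → Prop :=
  Classical.epsilon (SplitsEdges G W)

/-- Exchange the two members of a pair of sets at the vertices satisfying `c`. -/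
noncomputable def swapOn {V : Type*} [Fintype V] (c : V → Prop) (p : Finset V × Finset V) :
    Finset V × Finset V :=
  (Finset.univ.filter fun v => if c v then v ∈ p.2 else v ∈ p.1,
    Finset.univ.filter fun v => if c v then v ∈ p.1 else v ∈ p.2)

theorem mem_swapOn_fst {V : Type*} [Fintype V] {c : V → Prop} {p : Finset V × Finset V} {v : V} :
    v ∈ (swapOn c p).1 ↔ if c v then v ∈ p.2 else v ∈ p.1 := by
  simp [swapOn]

theorem mem_swapOn_snd {V : Type*} [Fintype V] {c : V → Prop} {p : Finset V × Finset V} {v : V} :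
    v ∈ (swapOn c p).2 ↔ if c v then v ∈ p.1 else v ∈ p.2 := by
  simp [swapOn]

theorem swapOn_union {V : Type*} [Fintype V] (c : V → Prop) (p : Finset V × Finset V) :
    (swapOn c p).1 ∪ (swapOn c p).2 = p.1 ∪ p.2 := by
  ext v
  rw [Finset.mem_union, Finset.mem_union, mem_swapOn_fst, mem_swapOn_snd]
  split_ifs <;> tauto

theorem swapOn_swapOn {V : Type*} [Fintype V] (c : V → Prop) (p : Finset V × Finset V) :
    swapOn c (swapOn c p) = p := by
  ext v
  · rw [mem_swapOn_fst, mem_swapOn_fst, mem_swapOn_snd]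
    split_ifs <;> rfl
  · rw [mem_swapOn_snd, mem_swapOn_fst, mem_swapOn_snd]
    split_ifs <;> rfl

/-- Exchange the members of a pair along the chosen splitting of their union. -/
noncomputable def bipartiteSwap {V : Type*} [Fintype V] (G : SimpleGraph V)
    (p : Finset V × Finset V) : Finset V × Finset V :=
  swapOn (splitting G (p.1 ∪ p.2)) p

theorem bipartiteSwap_involutive {V : Type*} [Fintype V] (G : SimpleGraph V) :
    Function.Involutive (bipartiteSwap G) := fun p => by
  unfold bipartiteSwap
  rw [swapOn_union, swapOn_swapOn]

theorem splitsEdges_of_indep {V : Type*} {G : SimpleGraph V} {A B : Finset V}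
    (hA : ∀ u ∈ A, ∀ v ∈ A, ¬ G.Adj u v) (hB : ∀ u ∈ B, ∀ v ∈ B, ¬ G.Adj u v) :
    SplitsEdges G (A ∪ B) (· ∈ A) := by
  intro u hu v hv huv hc
  rw [Finset.mem_union] at hu hv
  by_cases h : u ∈ A
  · exact hA u h v (hc.1 h) huv
  · exact hB u (hu.resolve_left h) v (hv.resolve_left fun hv => h (hc.2 hv)) huv

theorem bipartiteSwap_mem_crossIndepBipPairs {V : Type*} [Fintype V] {G : SimpleGraph V}
    {p : Finset V × Finset V} (hp : p ∈ indepSets G ×ˢ indepSets G) :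
    bipartiteSwap G p ∈ crossIndepBipPairs G := by
  simp only [indepSets, Finset.mem_product, Finset.mem_filter, Finset.mem_univ, true_and] at hp
  have hex : ∃ c, SplitsEdges G (p.1 ∪ p.2) c := ⟨_, splitsEdges_of_indep hp.1 hp.2⟩
  have hsplit : SplitsEdges G (p.1 ∪ p.2) (splitting G (p.1 ∪ p.2)) :=
    Classical.epsilon_spec hex
  simp only [crossIndepBipPairs, Finset.mem_filter, Finset.mem_univ, true_and, bipartiteSwap]
  refine ⟨fun a ha b hb hab => ?_, ?_⟩
  · have haW := swapOn_union _ p ▸ Finset.mem_union_left _ ha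
    have hbW := swapOn_union _ p ▸ Finset.mem_union_right _ hb
    have hne := hsplit a haW b hbW hab
    rw [mem_swapOn_fst] at ha
    rw [mem_swapOn_snd] at hb
    split_ifs at ha hb <;> tauto
  · rw [swapOn_union]
    exact (colorable_two_induce_iff G _).2 hex

theorem bipartiteSwap_mem_indepSets_product {V : Type*} [Fintype V] {G : SimpleGraph V}
    {p : Finset V × Finset V} (hp : p ∈ crossIndepBipPairs G) :
    bipartiteSwap G p ∈ indepSets G ×ˢ indepSets G := by
  simp only [crossIndepBipPairs, Finset.mem_filter, Finset.mem_univ, true_and] at hp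
  obtain ⟨hcross, hcol⟩ := hp
  have hsplit : SplitsEdges G (p.1 ∪ p.2) (splitting G (p.1 ∪ p.2)) :=
    Classical.epsilon_spec ((colorable_two_induce_iff G _).1 hcol)
  simp only [indepSets, Finset.mem_product, Finset.mem_filter, Finset.mem_univ, true_and,
    bipartiteSwap]
  refine ⟨fun a ha b hb hab => ?_, fun a ha b hb hab => ?_⟩
  · have haW := swapOn_union _ p ▸ Finset.mem_union_left _ ha
    have hbW := swapOn_union _ p ▸ Finset.mem_union_left _ hb
    have hne := hsplit a haW b hbW hab
    rw [mem_swapOn_fst] at ha hb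
    split_ifs at ha hb <;> tauto
  · have haW := swapOn_union _ p ▸ Finset.mem_union_right _ ha
    have hbW := swapOn_union _ p ▸ Finset.mem_union_right _ hb
    have hne := hsplit a haW b hbW hab
    rw [mem_swapOn_snd] at ha hb
    split_ifs at ha hb <;> tauto

/-- **Zhao's bipartite swapping trick.** There is a bijection between `I(G) × I(G)`
and `J(G)`; in particular `|J(G)| = i(G)²`. -/
theorem bipartite_swapping_trick {V : Type*} [Fintype V] (G : SimpleGraph V) :
    Nonempty ((↥(indepSets G ×ˢ indepSets G)) ≃ ↥(crossIndepBipPairs G)) ∧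
      (crossIndepBipPairs G).card = (indepSets G).card ^ 2 := by
  have hcard : (indepSets G ×ˢ indepSets G).card = (crossIndepBipPairs G).card :=
    Finset.card_nbij' (bipartiteSwap G) (bipartiteSwap G)
      (fun _ hp => bipartiteSwap_mem_crossIndepBipPairs hp)
      (fun _ hp => bipartiteSwap_mem_indepSets_product hp)
      (fun p _ => bipartiteSwap_involutive G p) (fun p _ => bipartiteSwap_involutive G p)
  exact ⟨⟨Finset.equivOfCardEq hcard⟩, by rw [← hcard, Finset.card_product, sq]⟩
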